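/- arXiv:1305.7413 — 2 statements merged into one kernel-verified Lean document; each statement's English description precedes it below -/
import Mathlib

section
/- For every Dyck automaton 𝒜 over a pushdown alphabet A, the set of labels of finite admissible paths of 𝒜 is a visibly pushdown language over A. -/
namespace SD

/-- The three kinds of letters of a pushdown alphabet. -/
inductive LetterKind : Type
  | call
  | ret
  | intern
  deriving DecidableEq

/-- A pushdown alphabet structure on `A`: a partition of the letters into
call letters, return letters and internal letters. -/
structure PushdownAlphabet (A : Type*) where
  kind : A → LetterKind

/-- Number of call letters of a word. -/
def callCount {A : Type*} (P : PushdownAlphabet A) (u : List A) : ℕ :=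
  u.countP (fun a => decide (P.kind a = LetterKind.call))

/-- Number of return letters of a word. -/
def retCount {A : Type*} (P : PushdownAlphabet A) (u : List A) : ℕ :=
  u.countP (fun a => decide (P.kind a = LetterKind.ret))

/-- A word is matched-return if every prefix has at least as many call letters
as return letters. -/
def MatchedReturn {A : Type*} (P : PushdownAlphabet A) (u : List A) : Prop :=
  ∀ v w : List A, u = v ++ w → retCount P v ≤ callCount P v

/-- A word is matched-call if every suffix has at least as many return letters
as call letters. -/
def MatchedCall {A : Type*} (P : PushdownAlphabet A) (u : List A) : Prop :=
  ∀ v w : List A, u = v ++ w → callCount P w ≤ retCount P w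

/-- A Dyck word is a word which is both matched-return and matched-call. -/
def IsDyck {A : Type*} (P : PushdownAlphabet A) (u : List A) : Prop :=
  MatchedReturn P u ∧ MatchedCall P u

/-- The factor of length `n` of a bi-infinite sequence starting at position `i`. -/
def factorAt {A : Type*} (x : ℤ → A) (i : ℤ) (n : ℕ) : List A :=
  (List.range n).map (fun k => x (i + (k : ℤ)))

/-- `w` is a (finite) factor of the bi-infinite sequence `x`. -/
def IsFactorOf {A : Type*} (w : List A) (x : ℤ → A) : Prop :=
  ∃ i : ℤ, w = factorAt x i w.length

/-- A Dyck automaton over alphabet `A` with states `Q`: a labeled graph together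
with a set of matched pairs of edges. -/
structure DyckAutomaton (A : Type*) (Q : Type*) where
  edges : Set (Q × A × Q)
  matched : Set ((Q × A × Q) × (Q × A × Q))

/-- Well-formedness of a Dyck automaton: matched pairs consist of edges of the
automaton, a call edge followed by a return edge. -/
def DyckAutomaton.WellFormed {A Q : Type*} (P : PushdownAlphabet A)
    (𝒜 : DyckAutomaton A Q) : Prop :=
  ∀ e f : Q × A × Q, (e, f) ∈ 𝒜.matched →
    e ∈ 𝒜.edges ∧ f ∈ 𝒜.edges ∧
    P.kind e.2.1 = LetterKind.call ∧ P.kind f.2.1 = LetterKind.ret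

/-- The label of a finite path. -/
def pathLabel {A Q : Type*} (π : List (Q × A × Q)) : List A :=
  π.map (fun e => e.2.1)

/-- A finite path of the underlying graph: a sequence of consecutive edges. -/
def IsPath {A Q : Type*} (𝒜 : DyckAutomaton A Q) (π : List (Q × A × Q)) : Prop :=
  (∀ e ∈ π, e ∈ 𝒜.edges) ∧ π.Chain' (fun e f => e.2.2 = f.1)

/-- A finite path is admissible if for any factor `e · π₁ · f` of it with `e` a call
edge, `f` a return edge and the label of `π₁` a Dyck word, `(e,f)` is a matched pair. -/
def IsAdmissible {A Q : Type*} (P : PushdownAlphabet A) (𝒜 : DyckAutomaton A Q)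
    (π : List (Q × A × Q)) : Prop :=
  IsPath 𝒜 π ∧
  ∀ (π₀ : List (Q × A × Q)) (e : Q × A × Q) (π₁ : List (Q × A × Q)) (f : Q × A × Q)
    (π₂ : List (Q × A × Q)), π = π₀ ++ e :: π₁ ++ f :: π₂ →
    P.kind e.2.1 = LetterKind.call → P.kind f.2.1 = LetterKind.ret →
    IsDyck P (pathLabel π₁) → (e, f) ∈ 𝒜.matched

/-- The finite factor of a bi-infinite path starting at index `i`, of length `n`. -/
def pathSeg {A Q : Type*} (π : ℤ → Q × A × Q) (i : ℤ) (n : ℕ) : List (Q × A × Q) :=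
  (List.range n).map (fun k => π (i + (k : ℤ)))

/-- A bi-infinite path is admissible if it is a bi-infinite path of the graph all of
whose finite factors are admissible. -/
def BiAdmissible {A Q : Type*} (P : PushdownAlphabet A) (𝒜 : DyckAutomaton A Q)
    (π : ℤ → Q × A × Q) : Prop :=
  (∀ i : ℤ, π i ∈ 𝒜.edges) ∧ (∀ i : ℤ, (π i).2.2 = (π (i + 1)).1) ∧
  ∀ (i : ℤ) (n : ℕ), IsAdmissible P 𝒜 (pathSeg π i n)

/-- The sofic-Dyck shift presented by a Dyck automaton: the set of labels of
bi-infinite admissible paths. -/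
def presents {A Q : Type*} (P : PushdownAlphabet A) (𝒜 : DyckAutomaton A Q) :
    Set (ℤ → A) :=
  { x | ∃ π : ℤ → Q × A × Q, BiAdmissible P 𝒜 π ∧ ∀ i : ℤ, (π i).2.1 = x i }

/-- A sofic-Dyck shift over `A`: a set presented by some (finite, well-formed)
Dyck automaton. -/
def IsSoficDyck {A : Type*} (P : PushdownAlphabet A) (X : Set (ℤ → A)) : Prop :=
  ∃ (N : ℕ) (𝒜 : DyckAutomaton A (Fin N)), 𝒜.WellFormed P ∧ X = presents P 𝒜

/-- A finite path goes from `p` to `q` (an empty path goes from `p` to `p`). -/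
def GoesFromTo {A Q : Type*} (π : List (Q × A × Q)) (p q : Q) : Prop :=
  (∀ e ∈ π.head?, e.1 = p) ∧ (∀ e ∈ π.getLast?, e.2.2 = q) ∧ (π = [] → p = q)

/-- A finite path starts at state `p`. -/
def StartsAt {A Q : Type*} (π : List (Q × A × Q)) (p : Q) : Prop :=
  ∀ e ∈ π.head?, e.1 = p

/-- A visibly pushdown automaton over `A` with states `Q` and stack alphabet `Γ`
(with a distinguished bottom-of-stack symbol `bot`). -/
structure VPA (A : Type*) (Q : Type*) (Γ : Type*) where
  init : Set Q
  bot : Γ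
  push : Set (Q × A × Q × Γ)
  pop : Set (Q × A × Γ × Q)
  internal : Set (Q × A × Q)
  final : Set Q

/-- `VPA.Steps P V c w c'` : there is a run of the visibly pushdown automaton `V`
labeled by `w` from configuration `c` to configuration `c'`.  A configuration is a
pair of a state and a stack; stacks are represented by the list of their symbols
above the bottom symbol, with the top of the stack at the end of the list. -/
inductive VPA.Steps {A Q Γ : Type*} (P : PushdownAlphabet A) (V : VPA A Q Γ) :
    Q × List Γ → List A → Q × List Γ → Prop
  | refl (c : Q × List Γ) : VPA.Steps P V c [] c
  | call {p : Q} {σ : List Γ} {a : A} {q : Q} {γ : Γ} {w : List A} {c : Q × List Γ} :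
      P.kind a = LetterKind.call → (p, a, q, γ) ∈ V.push → γ ≠ V.bot →
      VPA.Steps P V (q, σ ++ [γ]) w c → VPA.Steps P V (p, σ) (a :: w) c
  | pop {p : Q} {σ : List Γ} {a : A} {γ : Γ} {q : Q} {w : List A} {c : Q × List Γ} :
      P.kind a = LetterKind.ret → (p, a, γ, q) ∈ V.pop → γ ≠ V.bot →
      VPA.Steps P V (q, σ) w c → VPA.Steps P V (p, σ ++ [γ]) (a :: w) c
  | popBot {p : Q} {a : A} {q : Q} {w : List A} {c : Q × List Γ} :
      P.kind a = LetterKind.ret → (p, a, V.bot, q) ∈ V.pop →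
      VPA.Steps P V (q, []) w c → VPA.Steps P V (p, []) (a :: w) c
  | internal {p : Q} {σ : List Γ} {a : A} {q : Q} {w : List A} {c : Q × List Γ} :
      P.kind a = LetterKind.intern → (p, a, q) ∈ V.internal →
      VPA.Steps P V (q, σ) w c → VPA.Steps P V (p, σ) (a :: w) c

/-- A word is accepted by a visibly pushdown automaton if it labels a run from an
initial state with empty stack to a final state. -/
def VPA.Accepts {A Q Γ : Type*} (P : PushdownAlphabet A) (V : VPA A Q Γ)
    (w : List A) : Prop :=
  ∃ (p q : Q) (σ : List Γ), p ∈ V.init ∧ q ∈ V.final ∧ VPA.Steps P V (p, []) w (q, σ)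

/-- A visibly pushdown language over `A`: the set of words accepted by some (finite)
visibly pushdown automaton over `A`. -/
def IsVPL {A : Type*} (P : PushdownAlphabet A) (L : Set (List A)) : Prop :=
  ∃ (nQ nΓ : ℕ) (V : VPA A (Fin nQ) (Fin (nΓ + 1))),
    L = { w | VPA.Accepts P V w }

/-- A language is factorial if it contains every factor of each of its words. -/
def FactorialLang {A : Type*} (L : Set (List A)) : Prop :=
  ∀ u v w : List A, u ++ v ++ w ∈ L → v ∈ L

/-- A language is extensible if every word of it extends on both sides by nonempty
words to a word of the language. -/
def ExtensibleLang {A : Type*} (L : Set (List A)) : Prop :=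
  ∀ u ∈ L, ∃ w z : List A, w ≠ [] ∧ z ≠ [] ∧ w ++ u ++ z ∈ L

/-- The bi-extensible subset of `L`: words of `L` extensible on both sides by
arbitrarily long words within `L`. -/
def BiExt {A : Type*} (L : Set (List A)) : Set (List A) :=
  { w | w ∈ L ∧ ∀ n : ℕ, ∃ u v : List A, n ≤ u.length ∧ n ≤ v.length ∧ u ++ w ++ v ∈ L }

/-- The set of blocks (finite factors) of a set of bi-infinite sequences. -/
def blocksOf {A : Type*} (X : Set (ℤ → A)) : Set (List A) :=
  { w | ∃ x ∈ X, IsFactorOf w x }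

end SD

namespace SD

section Counts

variable {A : Type*} (P : PushdownAlphabet A)

theorem callCount_append (u v : List A) :
    callCount P (u ++ v) = callCount P u + callCount P v := List.countP_append

theorem retCount_append (u v : List A) :
    retCount P (u ++ v) = retCount P u + retCount P v := List.countP_append

variable {P}

theorem MatchedReturn.of_append {u v : List A} (h : MatchedReturn P (u ++ v)) :
    MatchedReturn P u :=
  fun x y hxy => h x (y ++ v) (by simp [hxy])

theorem matchedReturn_nil : MatchedReturn P [] := by
  intro v w h
  obtain ⟨rfl, rfl⟩ := List.append_eq_nil_iff.1 h.symm
  simp [retCount]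

theorem MatchedReturn.snoc {u : List A} {a : A} (hu : MatchedReturn P u)
    (h : retCount P (u ++ [a]) ≤ callCount P (u ++ [a])) : MatchedReturn P (u ++ [a]) := by
  intro v w hvw
  rcases List.eq_nil_or_concat' w with rfl | ⟨w', b, rfl⟩
  · rw [List.append_nil] at hvw
    exact hvw ▸ h
  · rw [← List.append_assoc] at hvw
    exact hu v w' (List.append_inj_left' hvw rfl)

theorem MatchedReturn.append {u v : List A} (hu : MatchedReturn P u) (hv : MatchedReturn P v) :
    MatchedReturn P (u ++ v) := by
  induction v using List.reverseRecOn with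
  | nil => simpa using hu
  | append_singleton v a ih =>
    rw [← List.append_assoc]
    refine (ih hv.of_append).snoc ?_
    have h₁ := hu u [] (by simp)
    have h₂ := hv (v ++ [a]) [] (by simp)
    rw [List.append_assoc, retCount_append, callCount_append P u]
    omega

theorem isDyck_iff {u : List A} :
    IsDyck P u ↔ MatchedReturn P u ∧ callCount P u = retCount P u := by
  constructor
  · rintro ⟨h₁, h₂⟩
    exact ⟨h₁, le_antisymm (h₂ [] u rfl) (h₁ u [] (by simp))⟩
  · rintro ⟨h₁, h₂⟩
    refine ⟨h₁, ?_⟩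
    rintro v w rfl
    have := h₁ v w rfl
    rw [callCount_append, retCount_append] at h₂
    omega

theorem isDyck_nil : IsDyck P [] :=
  isDyck_iff.2 ⟨matchedReturn_nil, rfl⟩

theorem IsDyck.append {u v : List A} (hu : IsDyck P u) (hv : IsDyck P v) :
    IsDyck P (u ++ v) := by
  rw [isDyck_iff] at *
  refine ⟨hu.1.append hv.1, ?_⟩
  rw [callCount_append, retCount_append, hu.2, hv.2]

theorem isDyck_intern {a : A} (ha : P.kind a = LetterKind.intern) : IsDyck P [a] := by
  have hc : callCount P [a] = 0 := by simp [callCount, ha]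
  have hr : retCount P [a] = 0 := by simp [retCount, ha]
  exact isDyck_iff.2 ⟨matchedReturn_nil.snoc (a := a) (by simp [hr]), by rw [hc, hr]⟩

theorem IsDyck.wrap {u : List A} {a b : A} (hu : IsDyck P u)
    (ha : P.kind a = LetterKind.call) (hb : P.kind b = LetterKind.ret) :
    IsDyck P ([a] ++ u ++ [b]) := by
  have hca : callCount P [a] = 1 := by simp [callCount, ha]
  have hra : retCount P [a] = 0 := by simp [retCount, ha]
  have hcb : callCount P [b] = 0 := by simp [callCount, hb]
  have hrb : retCount P [b] = 1 := by simp [retCount, hb]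
  rw [isDyck_iff] at *
  have ha' : MatchedReturn P [a] := matchedReturn_nil.snoc (a := a) (by simp [hra])
  have hcount : callCount P ([a] ++ u ++ [b]) = retCount P ([a] ++ u ++ [b]) := by
    simp only [callCount_append, retCount_append]
    omega
  exact ⟨(ha'.append hu.1).snoc hcount.ge, hcount⟩

end Counts

section Stack

variable {A Q : Type*} (P : PushdownAlphabet A)

/-- The effect of an edge on the stack of pending call edges (top first). -/
def stackStep (S : List (Q × A × Q)) (e : Q × A × Q) : List (Q × A × Q) :=
  match P.kind e.2.1 with
  | LetterKind.call => e :: S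
  | LetterKind.ret => S.tail
  | LetterKind.intern => S

/-- The stack of pending call edges (top first) after a path. -/
def pendingCalls (π : List (Q × A × Q)) : List (Q × A × Q) :=
  π.foldl (stackStep P) []

variable {P}

theorem stackStep_call {S : List (Q × A × Q)} {e : Q × A × Q}
    (h : P.kind e.2.1 = LetterKind.call) : stackStep P S e = e :: S := by
  simp [stackStep, h]

theorem stackStep_ret {S : List (Q × A × Q)} {e : Q × A × Q}
    (h : P.kind e.2.1 = LetterKind.ret) : stackStep P S e = S.tail := by
  simp [stackStep, h]

theorem stackStep_intern {S : List (Q × A × Q)} {e : Q × A × Q}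
    (h : P.kind e.2.1 = LetterKind.intern) : stackStep P S e = S := by
  simp [stackStep, h]

theorem pendingCalls_snoc (π : List (Q × A × Q)) (e : Q × A × Q) :
    pendingCalls P (π ++ [e]) = stackStep P (pendingCalls P π) e := by
  simp [pendingCalls]

theorem foldl_stackStep_of_matchedReturn (S π : List (Q × A × Q))
    (h : MatchedReturn P (pathLabel π)) :
    ∃ T, π.foldl (stackStep P) S = T ++ S ∧
      T.length + retCount P (pathLabel π) = callCount P (pathLabel π) := by
  induction π using List.reverseRecOn with
  | nil => exact ⟨[], rfl, rfl⟩
  | append_singleton π e ih =>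
    have hl : pathLabel (π ++ [e]) = pathLabel π ++ [e.2.1] := by simp [pathLabel]
    rw [hl] at h ⊢
    obtain ⟨T, hT, hlen⟩ := ih h.of_append
    have htot := h _ [] (List.append_nil _).symm
    rw [callCount_append, retCount_append] at htot ⊢
    rw [List.foldl_append, List.foldl_cons, List.foldl_nil, hT]
    cases hk : P.kind e.2.1 with
    | call =>
      refine ⟨e :: T, stackStep_call hk, ?_⟩
      simp [callCount, retCount, hk] at hlen ⊢
      omega
    | ret =>
      simp only [callCount, retCount] at hlen htot ⊢
      cases T with
      | nil =>
        simp [hk] at hlen htot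
        omega
      | cons t T =>
        refine ⟨T, by simp [stackStep_ret hk], ?_⟩
        simp [hk] at hlen ⊢
        omega
    | intern =>
      refine ⟨T, stackStep_intern hk, ?_⟩
      simpa [callCount, retCount, hk] using hlen

theorem foldl_stackStep_of_isDyck (S π : List (Q × A × Q)) (h : IsDyck P (pathLabel π)) :
    π.foldl (stackStep P) S = S := by
  rw [isDyck_iff] at h
  obtain ⟨T, hT, hlen⟩ := foldl_stackStep_of_matchedReturn S π h.1
  have : T = [] := List.eq_nil_of_length_eq_zero (by omega)
  simpa [this] using hT

theorem exists_split_of_pendingCalls (π : List (Q × A × Q)) (g : Q × A × Q)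
    (S : List (Q × A × Q)) (h : pendingCalls P π = g :: S) :
    ∃ π₀ π₁, π = π₀ ++ g :: π₁ ∧ P.kind g.2.1 = LetterKind.call ∧
      IsDyck P (pathLabel π₁) ∧ pendingCalls P π₀ = S := by
  induction hn : π.length using Nat.strong_induction_on generalizing π g S with
  | _ n ih =>
  rcases List.eq_nil_or_concat' π with rfl | ⟨π', e, rfl⟩
  · simp [pendingCalls] at h
  rw [pendingCalls_snoc] at h
  have hlt : π'.length < n := by simp [← hn]
  cases hk : P.kind e.2.1 with
  | call =>
    rw [stackStep_call hk] at h
    obtain ⟨rfl, rfl⟩ := List.cons.inj h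
    exact ⟨π', [], rfl, hk, isDyck_nil, rfl⟩
  | intern =>
    rw [stackStep_intern hk] at h
    obtain ⟨π₀, π₁, rfl, hg, hd, hS⟩ := ih _ hlt π' g S h rfl
    refine ⟨π₀, π₁ ++ [e], by simp, hg, ?_, hS⟩
    simpa [pathLabel] using hd.append (isDyck_intern hk)
  | ret =>
    rw [stackStep_ret hk] at h
    obtain ⟨f, hf⟩ : ∃ f, pendingCalls P π' = f :: g :: S := by
      cases hp : pendingCalls P π' with
      | nil => simp [hp] at h
      | cons f T => exact ⟨f, by simpa [hp] using h⟩
    obtain ⟨π₀, π₁, rfl, hfc, hd, hS⟩ := ih _ hlt π' f _ hf rfl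
    obtain ⟨π₂, π₃, rfl, hgc, hd', hS'⟩ :=
      ih π₀.length (by simp at hlt; omega) π₀ g S hS rfl
    refine ⟨π₂, π₃ ++ f :: π₁ ++ [e], by simp, hgc, ?_, hS'⟩
    simpa [pathLabel] using hd'.append (hd.wrap hfc hk)

theorem head?_pendingCalls_of_isDyck (π₀ π₁ : List (Q × A × Q)) {g : Q × A × Q}
    (hg : P.kind g.2.1 = LetterKind.call) (h : IsDyck P (pathLabel π₁)) :
    (pendingCalls P (π₀ ++ g :: π₁)).head? = some g := by
  rw [pendingCalls, List.foldl_append, List.foldl_cons, foldl_stackStep_of_isDyck _ _ h,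
    stackStep_call hg, List.head?_cons]

theorem isPath_iff {𝒜 : DyckAutomaton A Q} {π : List (Q × A × Q)} :
    IsPath 𝒜 π ↔ (∀ e ∈ π, e ∈ 𝒜.edges) ∧ π.IsChain (fun e f => e.2.2 = f.1) :=
  Iff.rfl

theorem isPath_snoc {𝒜 : DyckAutomaton A Q} {π : List (Q × A × Q)} {e : Q × A × Q} :
    IsPath 𝒜 (π ++ [e]) ↔
      IsPath 𝒜 π ∧ e ∈ 𝒜.edges ∧ ∀ f ∈ π.getLast?, f.2.2 = e.1 := by
  simp only [isPath_iff, List.isChain_append, List.mem_append, List.mem_singleton]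
  constructor
  · rintro ⟨h₁, h₂, -, h₃⟩
    exact ⟨⟨fun f hf => h₁ f (Or.inl hf), h₂⟩, h₁ e (Or.inr rfl), fun f hf => h₃ f hf e rfl⟩
  · rintro ⟨⟨h₁, h₂⟩, h₃, h₄⟩
    refine ⟨?_, h₂, by simp, ?_⟩
    · rintro f (hf | rfl)
      exacts [h₁ f hf, h₃]
    · intro f hf g hg
      obtain rfl : e = g := by simpa using hg
      exact h₄ f hf

theorem isAdmissible_snoc {𝒜 : DyckAutomaton A Q} {π : List (Q × A × Q)} {e : Q × A × Q} :
    IsAdmissible P 𝒜 (π ++ [e]) ↔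
      IsAdmissible P 𝒜 π ∧ e ∈ 𝒜.edges ∧ (∀ f ∈ π.getLast?, f.2.2 = e.1) ∧
      (P.kind e.2.1 = LetterKind.ret →
        ∀ g ∈ (pendingCalls P π).head?, (g, e) ∈ 𝒜.matched) := by
  constructor
  · rintro ⟨hp, hm⟩
    obtain ⟨hp₁, hp₂, hp₃⟩ := isPath_snoc.1 hp
    refine ⟨⟨hp₁, ?_⟩, hp₂, hp₃, ?_⟩
    · intro π₀ g π₁ f π₂ h
      exact hm π₀ g π₁ f (π₂ ++ [e]) (by simp [h])
    · intro he g hg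
      obtain ⟨S, hS⟩ := List.head?_eq_some_iff.1 hg
      obtain ⟨π₀, π₁, rfl, hgc, hd, -⟩ := exists_split_of_pendingCalls π g S hS
      exact hm π₀ g π₁ e [] (by simp) hgc he hd
  · rintro ⟨⟨hp, hm⟩, he, hl, htop⟩
    refine ⟨isPath_snoc.2 ⟨hp, he, hl⟩, ?_⟩
    intro π₀ g π₁ f π₂ h hg hf hd
    rcases List.eq_nil_or_concat' π₂ with rfl | ⟨π₂, f', rfl⟩
    · obtain ⟨rfl, hfe⟩ := List.append_inj' h rfl
      obtain rfl : e = f := by simpa using hfe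
      exact htop hf g (head?_pendingCalls_of_isDyck π₀ π₁ hg hd)
    · refine hm π₀ g π₁ f π₂ ?_ hg hf hd
      refine List.append_inj_left' (t₁ := [e]) (t₂ := [f']) ?_ rfl
      simpa using h

theorem isAdmissible_nil {𝒜 : DyckAutomaton A Q} : IsAdmissible P 𝒜 [] := by
  refine ⟨⟨by simp, List.isChain_nil⟩, ?_⟩
  intro π₀ e π₁ f π₂ h
  simp at h

theorem IsAdmissible.of_append {𝒜 : DyckAutomaton A Q} {π π' : List (Q × A × Q)}
    (h : IsAdmissible P 𝒜 (π ++ π')) : IsAdmissible P 𝒜 π := by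
  induction π' using List.reverseRecOn with
  | nil => simpa using h
  | append_singleton π' e ih =>
    rw [← List.append_assoc] at h
    exact ih (isAdmissible_snoc.1 h).1

end Stack

section Automaton

variable {A Q Q' Γ : Type*} {P : PushdownAlphabet A}

/-- The visibly pushdown automaton which follows the edges of a Dyck automaton and stores the
pending call edges on its stack; `s` and `t` encode states and edges. -/
def DyckAutomaton.toVPA (𝒜 : DyckAutomaton A Q) (s : Q → Q') (t : Q × A × Q → Γ) (bot : Γ) :
    VPA A Q' Γ where
  init := Set.univ
  bot := bot
  push := { x | ∃ e ∈ 𝒜.edges, x = (s e.1, e.2.1, s e.2.2, t e) }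
  pop := { x | ∃ e ∈ 𝒜.edges, (∃ g, (g, e) ∈ 𝒜.matched ∧ x = (s e.1, e.2.1, t g, s e.2.2)) ∨
    x = (s e.1, e.2.1, bot, s e.2.2) }
  internal := { x | ∃ e ∈ 𝒜.edges, x = (s e.1, e.2.1, s e.2.2) }
  final := Set.univ

/-- The stack of `DyckAutomaton.toVPA` after a path (top last). -/
def encodedStack (P : PushdownAlphabet A) (t : Q × A × Q → Γ) (π : List (Q × A × Q)) : List Γ :=
  (pendingCalls P π).reverse.map t

variable {𝒜 : DyckAutomaton A Q} {s : Q → Q'} {t : Q × A × Q → Γ} {bot : Γ}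

theorem exists_isAdmissible_of_steps (hs : Function.Injective s) (ht : Function.Injective t)
    (hbot : ∀ e, t e ≠ bot) {c c' : Q' × List Γ} {w : List A}
    (h : VPA.Steps P (𝒜.toVPA s t bot) c w c') (π₀ : List (Q × A × Q))
    (hπ : IsAdmissible P 𝒜 π₀) (hlast : ∀ f ∈ π₀.getLast?, s f.2.2 = c.1)
    (hstack : c.2 = encodedStack P t π₀) :
    ∃ π, IsAdmissible P 𝒜 (π₀ ++ π) ∧ pathLabel π = w := by
  induction h generalizing π₀ with
  | refl c => exact ⟨[], by simpa using hπ, rfl⟩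
  | @call p σ a q γ w c ha hpush hγ _ ih =>
    obtain ⟨e, he, heq⟩ := hpush
    obtain ⟨rfl, rfl, rfl, rfl⟩ : p = s e.1 ∧ a = e.2.1 ∧ q = s e.2.2 ∧ γ = t e := by
      simpa using heq
    obtain ⟨π, hadm, hlab⟩ := ih (π₀ ++ [e])
      (isAdmissible_snoc.2 ⟨hπ, he, fun f hf => hs (hlast f hf), by simp [ha]⟩) (by simp)
      (by simp_all [encodedStack, pendingCalls_snoc, stackStep_call])
    exact ⟨e :: π, by simpa using hadm, by simpa [pathLabel] using hlab⟩
  | @pop p σ a γ q w c ha hpop hγ _ ih =>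
    obtain ⟨e, he, ⟨g, hge, heq⟩ | heq⟩ := hpop
    · obtain ⟨rfl, rfl, rfl, rfl⟩ : p = s e.1 ∧ a = e.2.1 ∧ γ = t g ∧ q = s e.2.2 := by
        simpa using heq
      obtain ⟨S, hS, rfl⟩ : ∃ S, pendingCalls P π₀ = g :: S ∧ σ = S.reverse.map t := by
        cases hp : pendingCalls P π₀ with
        | nil => simp [encodedStack, hp] at hstack
        | cons f S =>
          simp only [encodedStack, hp, List.reverse_cons, List.map_append, List.map_cons,
            List.map_nil] at hstack
          obtain ⟨h₁, h₂⟩ := List.append_inj' hstack rfl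
          obtain rfl := ht (List.cons.inj h₂).1
          exact ⟨S, rfl, h₁⟩
      obtain ⟨π, hadm, hlab⟩ := ih (π₀ ++ [e])
        (isAdmissible_snoc.2 ⟨hπ, he, fun f hf => hs (hlast f hf), by
          intro _ f hf
          obtain rfl : g = f := by simpa [hS] using hf
          exact hge⟩) (by simp)
        (by simp [encodedStack, pendingCalls_snoc, stackStep_ret ha, hS])
      exact ⟨e :: π, by simpa using hadm, by simpa [pathLabel] using hlab⟩
    · simp only [Prod.mk.injEq] at heq
      exact absurd heq.2.2.1 hγ
  | @popBot p a q w c ha hpop _ ih =>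
    obtain ⟨e, he, ⟨g, hge, heq⟩ | heq⟩ := hpop
    · simp only [Prod.mk.injEq] at heq
      exact absurd heq.2.2.1.symm (hbot g)
    · simp only [Prod.mk.injEq] at heq
      obtain ⟨rfl, rfl, -, rfl⟩ := heq
      have hS : pendingCalls P π₀ = [] := by simpa [encodedStack] using hstack.symm
      obtain ⟨π, hadm, hlab⟩ := ih (π₀ ++ [e])
        (isAdmissible_snoc.2 ⟨hπ, he, fun f hf => hs (hlast f hf), by simp [hS]⟩) (by simp)
        (by simp [encodedStack, pendingCalls_snoc, stackStep_ret ha, hS])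
      exact ⟨e :: π, by simpa using hadm, by simpa [pathLabel] using hlab⟩
  | @internal p σ a q w c ha hedge _ ih =>
    obtain ⟨e, he, heq⟩ := hedge
    simp only [Prod.mk.injEq] at heq
    obtain ⟨rfl, rfl, rfl⟩ := heq
    obtain ⟨π, hadm, hlab⟩ := ih (π₀ ++ [e])
      (isAdmissible_snoc.2 ⟨hπ, he, fun f hf => hs (hlast f hf), by simp [ha]⟩) (by simp)
      (by simp_all [encodedStack, pendingCalls_snoc, stackStep_intern])
    exact ⟨e :: π, by simpa using hadm, by simpa [pathLabel] using hlab⟩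

theorem exists_steps_of_isAdmissible (hbot : ∀ e, t e ≠ bot) (π π₀ : List (Q × A × Q)) (q : Q')
    (hπ : IsAdmissible P 𝒜 (π₀ ++ π)) (hhead : ∀ e ∈ π.head?, s e.1 = q) :
    ∃ c, VPA.Steps P (𝒜.toVPA s t bot) (q, encodedStack P t π₀) (pathLabel π) c := by
  induction π generalizing π₀ q with
  | nil => exact ⟨_, VPA.Steps.refl _⟩
  | cons e π ih =>
    obtain rfl : s e.1 = q := hhead e rfl
    have hassoc : π₀ ++ e :: π = (π₀ ++ [e]) ++ π := by simp
    rw [hassoc] at hπ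
    obtain ⟨-, he, -, htop⟩ := isAdmissible_snoc.1 hπ.of_append
    have hnext : ∀ f ∈ π.head?, s f.1 = s e.2.2 := by
      intro f hf
      obtain ⟨π', rfl⟩ := List.head?_eq_some_iff.1 hf
      have hsplit : π₀ ++ [e] ++ f :: π' = (π₀ ++ [e] ++ [f]) ++ π' := by simp
      rw [hsplit] at hπ
      rw [(isAdmissible_snoc.1 hπ.of_append).2.2.1 e (by simp)]
    obtain ⟨c, hc⟩ := ih (π₀ ++ [e]) (s e.2.2) hπ hnext
    refine ⟨c, ?_⟩
    simp only [encodedStack, pendingCalls_snoc] at hc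
    cases hk : P.kind e.2.1 with
    | call =>
      refine VPA.Steps.call hk ⟨e, he, rfl⟩ (hbot e) ?_
      simpa [encodedStack, stackStep_call hk, pathLabel] using hc
    | ret =>
      rw [stackStep_ret hk] at hc
      cases hS : pendingCalls P π₀ with
      | nil =>
        simp only [encodedStack, hS] at hc ⊢
        exact VPA.Steps.popBot hk ⟨e, he, Or.inr rfl⟩ hc
      | cons g S =>
        simp only [encodedStack, hS, List.reverse_cons, List.map_append, List.map_cons,
          List.map_nil, List.tail_cons] at hc ⊢
        exact VPA.Steps.pop hk ⟨e, he, Or.inl ⟨g, htop hk g (by simp [hS]), rfl⟩⟩ (hbot g) hc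
    | intern =>
      rw [stackStep_intern hk] at hc
      exact VPA.Steps.internal hk ⟨e, he, rfl⟩ hc

theorem toVPA_accepts_iff [Nonempty Q'] (hs : Function.Injective s) (ht : Function.Injective t)
    (hbot : ∀ e, t e ≠ bot) {w : List A} :
    VPA.Accepts P (𝒜.toVPA s t bot) w ↔ ∃ π, IsAdmissible P 𝒜 π ∧ pathLabel π = w := by
  constructor
  · rintro ⟨p, q, σ, -, -, h⟩
    simpa using exists_isAdmissible_of_steps hs ht hbot h [] isAdmissible_nil (by simp) rfl
  · rintro ⟨π, hπ, rfl⟩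
    obtain ⟨p, hp⟩ : ∃ p : Q', ∀ e ∈ π.head?, s e.1 = p := by
      cases π with
      | nil => exact ⟨Classical.arbitrary Q', by simp⟩
      | cons e π => exact ⟨s e.1, by simp⟩
    obtain ⟨⟨q, σ⟩, h⟩ := exists_steps_of_isAdmissible hbot π [] p hπ hp
    exact ⟨p, q, σ, trivial, trivial, h⟩

end Automaton

end SD

open SD

/-- The set of labels of finite admissible paths of a Dyck automaton is a visibly
pushdown language. -/
theorem statement_11 {A : Type*} [Fintype A] (P : PushdownAlphabet A) {N : ℕ}
    (𝒜 : DyckAutomaton A (Fin N)) (h𝒜 : 𝒜.WellFormed P) :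
    IsVPL P { w : List A |
      ∃ π : List (Fin N × A × Fin N), IsAdmissible P 𝒜 π ∧ pathLabel π = w } := by
  let t : Fin N × A × Fin N → Fin (Fintype.card (Fin N × A × Fin N) + 1) :=
    fun e => (Fintype.equivFin _ e).succ
  refine ⟨N + 1, _, 𝒜.toVPA Fin.castSucc t 0, ?_⟩
  ext w
  exact (toVPA_accepts_iff (Fin.castSucc_injective N)
    ((Fin.succ_injective _).comp (Equiv.injective _)) (fun e => Fin.succ_ne_zero _)).symm
end

section
/- Let X be a sofic-Dyck shift over a pushdown alphabet A. Then the set B(X) of blocks of X is a visibly pushdown language over A. -/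
open SD

namespace SD

section Factors

variable {A B : Type*}

theorem factorAt_eq_map (x : ℤ → A) (i : ℤ) (n : ℕ) :
    factorAt x i n = (List.range n).map fun k : ℕ => x (i + (k : ℤ)) := by
  change List.map _ ((List.range n).flatMap fun k : ℕ => [(k : ℤ)]) = _
  rw [← List.map_eq_flatMap, List.map_map]
  rfl

theorem length_factorAt (x : ℤ → A) (i : ℤ) (n : ℕ) : (factorAt x i n).length = n := by
  simp [factorAt]

theorem factorAt_add (x : ℤ → A) (i : ℤ) (m n : ℕ) :
    factorAt x i (m + n) = factorAt x i m ++ factorAt x (i + m) n := by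
  simp only [factorAt_eq_map, List.range_add, List.map_append, List.map_map]
  congr 1
  apply List.map_congr_left
  intro k _
  simp [add_assoc]

theorem factorAt_one (x : ℤ → A) (i : ℤ) : factorAt x i 1 = [x i] := by
  simp [factorAt]

theorem factorAt_succ (x : ℤ → A) (i : ℤ) (n : ℕ) :
    factorAt x i (n + 1) = factorAt x i n ++ [x (i + n)] := by
  rw [factorAt_add, factorAt_one]

theorem factorAt_succ' (x : ℤ → A) (i : ℤ) (n : ℕ) :
    factorAt x i (n + 1) = x i :: factorAt x (i + 1) n := by
  rw [add_comm, factorAt_add, factorAt_one]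
  simp

theorem map_factorAt (f : A → B) (x : ℤ → A) (i : ℤ) (n : ℕ) :
    (factorAt x i n).map f = factorAt (fun j => f (x j)) i n := by
  simp [factorAt, Function.comp_def]

theorem factorAt_eq_append {x : ℤ → A} {i : ℤ} {n : ℕ} {u v : List A}
    (h : factorAt x i n = u ++ v) :
    n = u.length + v.length ∧ u = factorAt x i u.length ∧
      v = factorAt x (i + u.length) v.length := by
  have hn : n = u.length + v.length := by
    simpa [length_factorAt] using congrArg List.length h
  subst hn
  rw [factorAt_add] at h
  obtain ⟨h₁, h₂⟩ := List.append_inj h (length_factorAt _ _ _)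
  exact ⟨rfl, h₁.symm, h₂.symm⟩

theorem factorAt_eq_cons {x : ℤ → A} {i : ℤ} {n : ℕ} {a : A} {v : List A}
    (h : factorAt x i n = a :: v) :
    a = x i ∧ v = factorAt x (i + 1) v.length := by
  obtain ⟨-, h₁, h₂⟩ := factorAt_eq_append (u := [a]) (v := v) h
  simp only [List.length_singleton, factorAt_one, List.cons.injEq, and_true, Nat.cast_one] at h₁ h₂
  exact ⟨h₁, h₂⟩

end Factors

section Height

variable {A : Type*}

/-- The contribution of a letter to the nesting depth. -/
def letterHeight (P : PushdownAlphabet A) (a : A) : ℤ :=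
  match P.kind a with
  | .call => 1
  | .ret => -1
  | .intern => 0

theorem callCount_sub_retCount_append_singleton (P : PushdownAlphabet A) (u : List A) (a : A) :
    (callCount P (u ++ [a]) : ℤ) - retCount P (u ++ [a]) =
      callCount P u - retCount P u + letterHeight P a := by
  unfold callCount retCount letterHeight
  rcases h : P.kind a <;> simp [List.countP_append, h] <;> ring

theorem callCount_sub_retCount_factorAt (P : PushdownAlphabet A) {x : ℤ → A} {h : ℤ → ℤ}
    (hh : ∀ i, h (i + 1) = h i + letterHeight P (x i)) (i : ℤ) (n : ℕ) :
    (callCount P (factorAt x i n) : ℤ) - retCount P (factorAt x i n) = h (i + n) - h i := by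
  induction n with
  | zero => simp [factorAt, callCount, retCount]
  | succ n ih =>
    rw [factorAt_succ, callCount_sub_retCount_append_singleton, ih]
    have := hh (i + n)
    push_cast
    rw [← add_assoc, this]
    ring

theorem exists_int_antidifference (d : ℤ → ℤ) : ∃ h : ℤ → ℤ, ∀ i, h (i + 1) = h i + d i := by
  refine ⟨fun i => ∑ k ∈ Finset.Ico 0 i, d k - ∑ k ∈ Finset.Ico i 0, d k, fun i => ?_⟩
  dsimp only
  rcases le_or_gt 0 i with hi | hi
  · rw [Finset.Ico_eq_empty (a := i + 1) (by omega), Finset.Ico_eq_empty (a := i) (b := 0) (by omega),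
      show Finset.Ico 0 (i + 1) = insert i (Finset.Ico 0 i) by ext; simp; omega,
      Finset.sum_insert (by simp)]
    simp [add_comm]
  · rw [Finset.Ico_eq_empty (b := i + 1) (by omega), Finset.Ico_eq_empty (b := i) (by omega),
      show Finset.Ico i 0 = insert i (Finset.Ico (i + 1) 0) by ext; simp; omega,
      Finset.sum_insert (by simp)]
    simp

theorem isDyck_factorAt (P : PushdownAlphabet A) {x : ℤ → A} {h : ℤ → ℤ}
    (hh : ∀ i, h (i + 1) = h i + letterHeight P (x i)) {i : ℤ} {n : ℕ}
    (hend : h (i + n) = h i) (hge : ∀ k : ℕ, k ≤ n → h i ≤ h (i + k)) :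
    IsDyck P (factorAt x i n) := by
  constructor
  · intro v w hvw
    obtain ⟨hn, hv, -⟩ := factorAt_eq_append hvw
    have h₁ := callCount_sub_retCount_factorAt P hh i v.length
    rw [← hv] at h₁
    have := hge v.length (by omega)
    omega
  · intro v w hvw
    obtain ⟨hn, -, hw⟩ := factorAt_eq_append hvw
    have h₁ := callCount_sub_retCount_factorAt P hh (i + v.length) w.length
    rw [← hw, add_assoc, ← Nat.cast_add, ← hn] at h₁
    have := hge v.length (by omega)
    omega

end Height

section Configurations

variable {A Q : Type*}

/-- An infinite stack of call edges, `none` standing for an absent call. -/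
abbrev EdgeStack (A Q : Type*) := Stream' (Option (Q × A × Q))

/-- The effect of an edge on the stack of pending calls. -/
inductive StackStep (P : PushdownAlphabet A) (𝒜 : DyckAutomaton A Q) (e : Q × A × Q) :
    EdgeStack A Q → EdgeStack A Q → Prop
  | call (S : EdgeStack A Q) : P.kind e.2.1 = LetterKind.call →
      StackStep P 𝒜 e S (Stream'.cons (some e) S)
  | ret (o : Option (Q × A × Q)) (S : EdgeStack A Q) : P.kind e.2.1 = LetterKind.ret →
      (∀ e' ∈ o, (e', e) ∈ 𝒜.matched) → StackStep P 𝒜 e (Stream'.cons o S) S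
  | intern (S : EdgeStack A Q) : P.kind e.2.1 = LetterKind.intern → StackStep P 𝒜 e S S

/-- A step of the Dyck automaton on configurations consisting of a state and a stack. -/
def ConfigStep (P : PushdownAlphabet A) (𝒜 : DyckAutomaton A Q) (c : Q × EdgeStack A Q) (a : A)
    (c' : Q × EdgeStack A Q) : Prop :=
  (c.1, a, c'.1) ∈ 𝒜.edges ∧ StackStep P 𝒜 (c.1, a, c'.1) c.2 c'.2

/-- Finite runs of the Dyck automaton on configurations. -/
inductive ConfigRun (P : PushdownAlphabet A) (𝒜 : DyckAutomaton A Q) :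
    Q × EdgeStack A Q → List A → Q × EdgeStack A Q → Prop
  | nil (c : Q × EdgeStack A Q) : ConfigRun P 𝒜 c [] c
  | cons {c d c' : Q × EdgeStack A Q} {a : A} {w : List A} :
      ConfigStep P 𝒜 c a d → ConfigRun P 𝒜 d w c' → ConfigRun P 𝒜 c (a :: w) c'

theorem exists_append_of_dyck {P : PushdownAlphabet A} {𝒜 : DyckAutomaton A Q}
    {π : ℤ → Q × A × Q} {S : ℤ → EdgeStack A Q} (hS : ∀ i, StackStep P 𝒜 (π i) (S i) (S (i + 1)))
    {i : ℤ} {n : ℕ} (hD : MatchedReturn P (factorAt (fun j => (π j).2.1) i n)) (k : ℕ)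
    (hk : k ≤ n) :
    ∃ l : List (Option (Q × A × Q)), S (i + k) = l ++ₛ S i ∧
      l.length + retCount P (factorAt (fun j => (π j).2.1) i k) =
        callCount P (factorAt (fun j => (π j).2.1) i k) := by
  induction k with
  | zero => exact ⟨[], by simp [Stream'.nil_append_stream], by simp [factorAt, callCount, retCount]⟩
  | succ k ih =>
    obtain ⟨l, hl, hc⟩ := ih (by omega)
    have hle : retCount P (factorAt (fun j => (π j).2.1) i (k + 1)) ≤
        callCount P (factorAt (fun j => (π j).2.1) i (k + 1)) := by
      obtain ⟨m, rfl⟩ := Nat.exists_eq_add_of_le hk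
      exact hD _ _ (factorAt_add _ _ _ _)
    have hd := callCount_sub_retCount_append_singleton P (factorAt (fun j => (π j).2.1) i k)
      (π (i + k)).2.1
    rw [factorAt_succ] at hle ⊢
    have hs := hS (i + k)
    have hcast : i + ((k + 1 : ℕ) : ℤ) = i + k + 1 := by push_cast; ring
    rw [hcast]
    unfold letterHeight at hd
    generalize S (i + k + 1) = T at hs
    generalize hU : S (i + k) = U at hs
    rw [hl] at hU
    cases hs with
    | call _ h =>
      rw [h] at hd
      refine ⟨some (π (i + k)) :: l, by rw [← hU, Stream'.cons_append_stream], ?_⟩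
      simp only [List.length_cons]
      simp only at hd
      omega
    | ret o _ h hm =>
      rw [h] at hd
      simp only at hd
      cases l with
      | nil => simp only [List.length_nil] at hc; omega
      | cons o' l =>
        rw [Stream'.cons_append_stream] at hU
        refine ⟨l, (Stream'.cons_injective2 hU).2.symm, ?_⟩
        simp only [List.length_cons] at hc
        omega
    | intern _ h =>
      rw [h] at hd
      simp only at hd
      exact ⟨l, hU.symm, by omega⟩

theorem biAdmissible_of_stackStep {P : PushdownAlphabet A} {𝒜 : DyckAutomaton A Q}
    {π : ℤ → Q × A × Q} (hE : ∀ i, π i ∈ 𝒜.edges) (hc : ∀ i, (π i).2.2 = (π (i + 1)).1)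
    {S : ℤ → EdgeStack A Q} (hS : ∀ i, StackStep P 𝒜 (π i) (S i) (S (i + 1))) :
    BiAdmissible P 𝒜 π := by
  refine ⟨hE, hc, fun i n => ⟨⟨?_, ?_⟩, ?_⟩⟩
  · intro e he
    change e ∈ factorAt π i n at he
    rw [factorAt_eq_map] at he
    obtain ⟨k, -, rfl⟩ := List.mem_map.1 he
    exact hE _
  · change (factorAt π i n).IsChain _
    rw [factorAt_eq_map]
    refine List.isChain_iff_getElem.2 fun k hk => ?_
    simpa [add_assoc] using hc (i + k)
  · intro π₀ e π₁ f π₂ hπ he hf hD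
    rw [List.append_assoc] at hπ
    obtain ⟨-, -, h₁⟩ := factorAt_eq_append (x := π) hπ
    obtain ⟨he', h₂⟩ := factorAt_eq_cons h₁.symm
    obtain ⟨-, h₃, h₄⟩ := factorAt_eq_append h₂.symm
    obtain ⟨hf', -⟩ := factorAt_eq_cons h₄.symm
    generalize i + (π₀.length : ℤ) = j at *
    have hlab : pathLabel π₁ = factorAt (fun j => (π j).2.1) (j + 1) π₁.length := by
      unfold pathLabel
      conv_lhs => rw [h₃]
      exact map_factorAt _ _ _ _
    rw [hlab] at hD
    obtain ⟨hDr, hDc⟩ := hD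
    obtain ⟨l, hl, hcount⟩ := exists_append_of_dyck hS hDr π₁.length le_rfl
    have hle := hDc [] _ (List.nil_append _).symm
    have hl0 : l = [] := List.eq_nil_of_length_eq_zero (by omega)
    rw [hl0, Stream'.nil_append_stream] at hl
    have s₁ := hS j
    have s₂ := hS (j + 1 + π₁.length)
    rw [hl, ← hf'] at s₂
    rw [← he'] at s₁
    generalize S (j + 1) = T at s₁ s₂
    generalize S (j + 1 + π₁.length + 1) = U at s₂
    generalize S j = V at s₁
    cases s₁ with
    | call _ _ =>
      generalize hW : Stream'.cons (some e) V = W at s₂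
      cases s₂ with
      | call _ h => simp [h] at hf
      | ret o _ _ hm => exact hm e (by rw [← (Stream'.cons_injective2 hW).1]; rfl)
      | intern _ h => simp [h] at hf
    | ret _ _ h _ => simp [h] at he
    | intern _ h => simp [h] at he

/-- `j` is the last position before `i` whose height is at most `m`. -/
def IsLastBelow (h : ℤ → ℤ) (i m j : ℤ) : Prop :=
  j < i ∧ h j ≤ m ∧ ∀ l, j < l → l < i → m < h l

theorem isLastBelow_succ {h : ℤ → ℤ} {i m : ℤ} (hm : m < h i) :
    IsLastBelow h (i + 1) m = IsLastBelow h i m := by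
  funext j
  apply propext
  constructor
  · rintro ⟨h₁, h₂, h₃⟩
    have hne : j ≠ i := by rintro rfl; omega
    exact ⟨by omega, h₂, fun l hl hl' => h₃ l hl (by omega)⟩
  · rintro ⟨h₁, h₂, h₃⟩
    refine ⟨by omega, h₂, fun l hl hl' => ?_⟩
    rcases eq_or_ne l i with rfl | hne
    · exact hm
    · exact h₃ l hl (by omega)

theorem IsLastBelow.unique {h : ℤ → ℤ} {i m j k : ℤ} (hj : IsLastBelow h i m j)
    (hk : IsLastBelow h i m k) : j = k := by
  obtain ⟨h₁, h₂, h₃⟩ := hj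
  obtain ⟨h₄, h₅, h₆⟩ := hk
  rcases lt_trichotomy j k with hlt | rfl | hlt
  · have := h₃ k hlt h₄; omega
  · rfl
  · have := h₆ j hlt h₁; omega

open Classical in
/-- The value of `π` at the position satisfying `R`, if there is one. -/
noncomputable def valueAt {B : Type*} (π : ℤ → B) (R : ℤ → Prop) : Option B :=
  if h : ∃ j, R j then some (π h.choose) else none

theorem exists_of_mem_valueAt {B : Type*} {π : ℤ → B} {R : ℤ → Prop} {b : B}
    (h : b ∈ valueAt π R) : ∃ j, R j ∧ b = π j := by
  unfold valueAt at h
  split_ifs at h with hR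
  · exact ⟨_, hR.choose_spec, (Option.some.inj h).symm⟩
  · simp at h

theorem valueAt_eq_some {B : Type*} {π : ℤ → B} {R : ℤ → Prop} {j : ℤ} (hj : R j)
    (hu : ∀ k, R k → k = j) : valueAt π R = some (π j) := by
  unfold valueAt
  rw [dif_pos ⟨j, hj⟩, hu _ (Exists.choose_spec (⟨j, hj⟩ : ∃ j, R j))]

theorem exists_stackStep_of_biAdmissible {P : PushdownAlphabet A} {𝒜 : DyckAutomaton A Q}
    {π : ℤ → Q × A × Q} (hπ : BiAdmissible P 𝒜 π) :
    ∃ S : ℤ → EdgeStack A Q, ∀ i, StackStep P 𝒜 (π i) (S i) (S (i + 1)) := by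
  obtain ⟨h, hh⟩ := exists_int_antidifference (fun i => letterHeight P (π i).2.1)
  refine ⟨fun i k => valueAt π (IsLastBelow h i (h i - 1 - k)), fun i => ?_⟩
  dsimp only
  have hi := hh i
  unfold letterHeight at hi
  rcases hk : P.kind (π i).2.1 with _ | _ | _
  · rw [hk] at hi
    simp only at hi
    have : (fun k : ℕ => valueAt π (IsLastBelow h (i + 1) (h (i + 1) - 1 - k)) : EdgeStack A Q) =
        Stream'.cons (some (π i))
          (fun k : ℕ => valueAt π (IsLastBelow h i (h i - 1 - k)) : EdgeStack A Q) := by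
      funext k
      cases k with
      | zero =>
        have hlast : IsLastBelow h (i + 1) (h (i + 1) - 1 - (0 : ℕ)) i :=
          ⟨by omega, by simp [hi], fun l _ _ => by omega⟩
        exact valueAt_eq_some hlast fun k hk => hk.unique hlast
      | succ k =>
        change valueAt π _ = valueAt π _
        rw [isLastBelow_succ (by push_cast; omega)]
        congr 2
        push_cast
        omega
    rw [this]
    exact .call _ hk
  · rw [hk] at hi
    simp only at hi
    have : (fun k : ℕ => valueAt π (IsLastBelow h i (h i - 1 - k)) : EdgeStack A Q) =
        Stream'.cons (valueAt π (IsLastBelow h i (h i - 1)))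
          (fun k : ℕ => valueAt π (IsLastBelow h (i + 1) (h (i + 1) - 1 - k)) : EdgeStack A Q) := by
      funext k
      cases k with
      | zero =>
        change valueAt π _ = valueAt π _
        simp
      | succ k =>
        change valueAt π _ = valueAt π _
        rw [isLastBelow_succ (by omega)]
        congr 2
        push_cast
        omega
    rw [this]
    refine .ret _ _ hk fun e he => ?_
    obtain ⟨j, ⟨hji, hjm, hlast⟩, rfl⟩ := exists_of_mem_valueAt he
    have hj := hh j
    have hnext : h i ≤ h (j + 1) := by
      rcases eq_or_ne (j + 1) i with heq | hne
      · rw [heq]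
      · have := hlast (j + 1) (by omega) (by omega); omega
    have hcall : P.kind (π j).2.1 = LetterKind.call := by
      unfold letterHeight at hj
      rcases hkj : P.kind (π j).2.1 with _ | _ | _ <;> rw [hkj] at hj <;> simp only at hj
      · omega
      · omega
    have hj' : h (j + 1) = h i := by
      simp only [letterHeight, hcall] at hj
      omega
    obtain ⟨n, hn⟩ := Int.eq_ofNat_of_zero_le (show 0 ≤ i - (j + 1) by omega)
    have hin : i = j + 1 + n := by omega
    refine (hπ.2.2 j (n + 2)).2 [] (π j) (factorAt π (j + 1) n) (π i) [] ?_ hcall hk ?_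
    · change factorAt π j (n + 1 + 1) = _
      rw [factorAt_succ', factorAt_succ, ← hin]
      simp
    · unfold pathLabel
      rw [map_factorAt]
      refine isDyck_factorAt P hh (by rw [← hin, hj']) fun k hk => ?_
      rcases Nat.eq_zero_or_pos k with rfl | hpos
      · simp
      · rcases eq_or_lt_of_le hk with rfl | hlt
        · rw [← hin, hj']
        · have := hlast (j + 1 + k) (by omega) (by omega)
          omega
  · rw [hk] at hi
    simp only at hi
    have : (fun k : ℕ => valueAt π (IsLastBelow h (i + 1) (h (i + 1) - 1 - k)) : EdgeStack A Q) =
        (fun k : ℕ => valueAt π (IsLastBelow h i (h i - 1 - k)) : EdgeStack A Q) := by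
      funext k
      rw [isLastBelow_succ (by omega), hi, add_zero]
    rw [this]
    exact .intern _ hk

theorem mem_presents_iff {P : PushdownAlphabet A} {𝒜 : DyckAutomaton A Q} {x : ℤ → A} :
    x ∈ presents P 𝒜 ↔
      ∃ c : ℤ → Q × EdgeStack A Q, ∀ i, ConfigStep P 𝒜 (c i) (x i) (c (i + 1)) := by
  constructor
  · rintro ⟨π, hπ, hx⟩
    obtain ⟨S, hS⟩ := exists_stackStep_of_biAdmissible hπ
    refine ⟨fun i => ((π i).1, S i), fun i => ?_⟩
    have he : ((π i).1, x i, (π (i + 1)).1) = π i := by rw [← hx, ← hπ.2.1]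
    unfold ConfigStep
    dsimp only
    rw [he]
    exact ⟨hπ.1 i, hS i⟩
  · rintro ⟨c, hc⟩
    exact ⟨fun i => ((c i).1, x i, (c (i + 1)).1),
      biAdmissible_of_stackStep (fun i => (hc i).1) (fun _ => rfl) fun i => (hc i).2, fun _ => rfl⟩

end Configurations

section InfiniteChains

variable {α : Type*}

/-- There is an infinite `R`-chain starting at `c`. -/
def HasInfiniteChain (R : α → α → Prop) (c : α) : Prop :=
  ∃ g : ℕ → α, g 0 = c ∧ ∀ n, R (g n) (g (n + 1))

theorem HasInfiniteChain.exists_step {R : α → α → Prop} {c : α} (h : HasInfiniteChain R c) :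
    ∃ d, R c d ∧ HasInfiniteChain R d := by
  obtain ⟨g, rfl, hg⟩ := h
  exact ⟨g 1, hg 0, fun n => g (n + 1), rfl, fun n => hg (n + 1)⟩

theorem hasInfiniteChain_of_invariant {R : α → α → Prop} {Z : α → Prop}
    (hZ : ∀ c, Z c → ∃ d, R c d ∧ Z d) {c : α} (hc : Z c) : HasInfiniteChain R c := by
  choose f hf hfZ using hZ
  let g : ℕ → { c // Z c } := fun n => (fun c => ⟨f c.1 c.2, hfZ c.1 c.2⟩)^[n] ⟨c, hc⟩
  refine ⟨fun n => (g n).1, rfl, fun n => ?_⟩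
  have : g (n + 1) = ⟨f (g n).1 (g n).2, hfZ _ _⟩ := Function.iterate_succ_apply' _ _ _
  dsimp only
  rw [this]
  exact hf _ _

/-- A relation on configurations that only looks at the stack through its top symbols. -/
def IsStackLocal {Q B : Type*} (R : Q × Stream' B → Q × Stream' B → Prop) : Prop :=
  ∀ p o l S q T, R (p, (o :: l) ++ₛ S) (q, T) →
    ∃ l' : List B, T = l' ++ₛ S ∧ ∀ S', R (p, (o :: l) ++ₛ S') (q, l' ++ₛ S')

theorem IsStackLocal.hasInfiniteChain_append {Q B : Type*}
    {R : Q × Stream' B → Q × Stream' B → Prop} (hR : IsStackLocal R) {S S' : Stream' B}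
    (h : ∀ p, HasInfiniteChain R (p, S) → HasInfiniteChain R (p, S')) {p : Q} {l : List B}
    (hp : HasInfiniteChain R (p, l ++ₛ S)) : HasInfiniteChain R (p, l ++ₛ S') := by
  refine hasInfiniteChain_of_invariant (Z := fun c => HasInfiniteChain R c ∨
    ∃ p l, c = (p, l ++ₛ S') ∧ HasInfiniteChain R (p, l ++ₛ S)) ?_ (Or.inr ⟨p, l, rfl, hp⟩)
  rintro c hc
  have key : HasInfiniteChain R c ∨ ∃ p o l, c = (p, (o :: l) ++ₛ S') ∧
      HasInfiniteChain R (p, (o :: l) ++ₛ S) := by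
    rcases hc with hc | ⟨p, l, rfl, hl⟩
    · exact Or.inl hc
    · cases l with
      | nil => exact Or.inl (h p hl)
      | cons o l => exact Or.inr ⟨p, o, l, rfl, hl⟩
  rcases key with hc | ⟨p, o, l, rfl, hl⟩
  · obtain ⟨d, hd, hd'⟩ := hc.exists_step
    exact ⟨d, hd, Or.inl hd'⟩
  · obtain ⟨⟨q, T⟩, hd, hd'⟩ := hl.exists_step
    obtain ⟨l', rfl, hl'⟩ := hR _ _ _ _ _ _ hd
    exact ⟨_, hl' S', Or.inr ⟨q, l', rfl, hd'⟩⟩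

end InfiniteChains

section Types

variable {A Q : Type*}

theorem isStackLocal_configStep (P : PushdownAlphabet A) (𝒜 : DyckAutomaton A Q) :
    IsStackLocal fun c d => ∃ a, ConfigStep P 𝒜 c a d := by
  rintro p o l S q T ⟨a, he, hs⟩
  dsimp only at he hs
  generalize hU : (o :: l) ++ₛ S = U at hs
  cases hs with
  | call _ h =>
    subst hU
    refine ⟨some (p, a, q) :: o :: l, rfl, fun S' => ⟨a, he, ?_⟩⟩
    exact .call _ h
  | ret o' _ h hm =>
    rw [Stream'.cons_append_stream] at hU
    obtain ⟨rfl, rfl⟩ := Stream'.cons_injective2 hU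
    exact ⟨l, rfl, fun S' => ⟨a, he, .ret _ _ h hm⟩⟩
  | intern _ h =>
    subst hU
    exact ⟨o :: l, rfl, fun S' => ⟨a, he, .intern _ h⟩⟩

theorem isStackLocal_swap_configStep (P : PushdownAlphabet A) (𝒜 : DyckAutomaton A Q) :
    IsStackLocal fun c d => ∃ a, ConfigStep P 𝒜 d a c := by
  rintro p o l S q T ⟨a, he, hs⟩
  dsimp only at he hs
  generalize hU : (o :: l) ++ₛ S = U at hs
  cases hs with
  | call _ h =>
    rw [Stream'.cons_append_stream] at hU
    obtain ⟨rfl, rfl⟩ := Stream'.cons_injective2 hU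
    exact ⟨l, rfl, fun S' => ⟨a, he, .call _ h⟩⟩
  | ret o' _ h hm =>
    subst hU
    exact ⟨o' :: o :: l, rfl, fun S' => ⟨a, he, .ret _ _ h hm⟩⟩
  | intern _ h =>
    subst hU
    exact ⟨o :: l, rfl, fun S' => ⟨a, he, .intern _ h⟩⟩

/-- There is a right-infinite run from `c`. -/
def RightExtendable (P : PushdownAlphabet A) (𝒜 : DyckAutomaton A Q) :
    Q × EdgeStack A Q → Prop :=
  HasInfiniteChain fun c d => ∃ a, ConfigStep P 𝒜 c a d

/-- There is a left-infinite run to `c`. -/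
def LeftExtendable (P : PushdownAlphabet A) (𝒜 : DyckAutomaton A Q) :
    Q × EdgeStack A Q → Prop :=
  HasInfiniteChain fun c d => ∃ a, ConfigStep P 𝒜 d a c

/-- The states which, together with the stack `S`, are left (resp. right) extendable. -/
def stackType (P : PushdownAlphabet A) (𝒜 : DyckAutomaton A Q) (S : EdgeStack A Q) :
    Set Q × Set Q :=
  ({p | LeftExtendable P 𝒜 (p, S)}, {p | RightExtendable P 𝒜 (p, S)})

theorem stackType_cons_congr {P : PushdownAlphabet A} {𝒜 : DyckAutomaton A Q}
    {S S' : EdgeStack A Q} (h : stackType P 𝒜 S = stackType P 𝒜 S') (o : Option (Q × A × Q)) :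
    stackType P 𝒜 (Stream'.cons o S) = stackType P 𝒜 (Stream'.cons o S') := by
  have key : ∀ {S S' : EdgeStack A Q}, stackType P 𝒜 S = stackType P 𝒜 S' →
      (stackType P 𝒜 (Stream'.cons o S)).1 ⊆ (stackType P 𝒜 (Stream'.cons o S')).1 ∧
      (stackType P 𝒜 (Stream'.cons o S)).2 ⊆ (stackType P 𝒜 (Stream'.cons o S')).2 := by
    intro S S' h
    constructor
    · intro p hp
      exact (isStackLocal_swap_configStep P 𝒜).hasInfiniteChain_append (l := [o])
        (fun p => (Set.ext_iff.1 (congrArg Prod.fst h) p).1) hp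
    · intro p hp
      exact (isStackLocal_configStep P 𝒜).hasInfiniteChain_append (l := [o])
        (fun p => (Set.ext_iff.1 (congrArg Prod.snd h) p).1) hp
  exact Prod.ext ((key h).1.antisymm (key h.symm).1) ((key h).2.antisymm (key h.symm).2)

theorem configRun_factorAt {P : PushdownAlphabet A} {𝒜 : DyckAutomaton A Q}
    {c : ℤ → Q × EdgeStack A Q} {x : ℤ → A} (hc : ∀ i, ConfigStep P 𝒜 (c i) (x i) (c (i + 1)))
    (i : ℤ) (n : ℕ) : ConfigRun P 𝒜 (c i) (factorAt x i n) (c (i + n)) := by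
  induction n generalizing i with
  | zero => simpa [factorAt] using ConfigRun.nil (c i)
  | succ n ih =>
    rw [factorAt_succ']
    have := ih (i + 1)
    rw [show i + 1 + (n : ℤ) = i + (n + 1 : ℕ) by push_cast; ring] at this
    exact .cons (hc i) this

theorem ConfigRun.exists_rightInfinite {P : PushdownAlphabet A} {𝒜 : DyckAutomaton A Q}
    {c c' : Q × EdgeStack A Q} {w : List A} (hw : ConfigRun P 𝒜 c w c')
    (hc' : RightExtendable P 𝒜 c') :
    ∃ (g : ℕ → Q × EdgeStack A Q) (y : ℕ → A), g 0 = c ∧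
      (∀ n, ConfigStep P 𝒜 (g n) (y n) (g (n + 1))) ∧ w = (List.range w.length).map y := by
  induction hw with
  | nil c =>
    obtain ⟨g, hg, hs⟩ := hc'
    choose y hy using hs
    exact ⟨g, y, hg, hy, rfl⟩
  | @cons c d c' a w hs _ ih =>
    obtain ⟨g, y, rfl, hy, hw⟩ := ih hc'
    refine ⟨fun n => Nat.casesOn n c g, fun n => Nat.casesOn n a y, rfl, ?_, ?_⟩
    · rintro (_ | n)
      · exact hs
      · exact hy n
    · rw [List.length_cons, List.range_succ_eq_map, List.map_cons, List.map_map]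
      congr 1

theorem mem_blocksOf_presents_iff {P : PushdownAlphabet A} {𝒜 : DyckAutomaton A Q} {w : List A} :
    w ∈ blocksOf (presents P 𝒜) ↔
      ∃ c c', LeftExtendable P 𝒜 c ∧ ConfigRun P 𝒜 c w c' ∧ RightExtendable P 𝒜 c' := by
  constructor
  · rintro ⟨x, hx, i, hw⟩
    obtain ⟨c, hc⟩ := mem_presents_iff.1 hx
    refine ⟨c i, c (i + w.length), ⟨fun n => c (i - n), by simp, fun n => ⟨x (i - (n + 1)), ?_⟩⟩,
      ?_, ⟨fun n => c (i + w.length + n), by simp, fun n => ⟨x (i + w.length + n), ?_⟩⟩⟩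
    · have := hc (i - (n + 1))
      rw [show i - ((n : ℤ) + 1) + 1 = i - n by ring] at this
      exact_mod_cast this
    · rw [hw, length_factorAt]
      exact configRun_factorAt hc i _
    · have := hc (i + w.length + n)
      rw [add_assoc _ (n : ℤ) 1] at this
      exact_mod_cast this
  · rintro ⟨c, c', ⟨l, hl, hs⟩, hrun, hr⟩
    choose z hz using hs
    obtain ⟨g, y, hg, hy, hw⟩ := hrun.exists_rightInfinite hr
    refine ⟨fun i => Int.casesOn i y z, mem_presents_iff.2
      ⟨fun i => Int.casesOn i g fun n => l (n + 1), ?_⟩, 0, ?_⟩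
    · rintro (n | _ | n)
      · exact hy n
      · have := hz 0
        rw [hl, ← hg] at this
        exact this
      · exact hz (n + 1)
    · conv_lhs => rw [hw]
      rw [factorAt_eq_map]
      refine List.map_congr_left fun k _ => ?_
      rw [zero_add]
      rfl

end Types

section Automaton

variable {A Q : Type*}

/-- The visibly pushdown automaton simulating a Dyck automaton: its states record the current
state and the type of the current stack, and its stack records pending calls together with the
type of the stack below them. -/
def blockVPA (P : PushdownAlphabet A) (𝒜 : DyckAutomaton A Q) :
    VPA A (Q × (Set Q × Set Q)) (Option ((Q × A × Q) × (Set Q × Set Q))) where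
  init := {s | ∃ S, s.2 = stackType P 𝒜 S ∧ s.1 ∈ s.2.1}
  bot := none
  push := {d | (d.1.1, d.2.1, d.2.2.1.1) ∈ 𝒜.edges ∧
    d.2.2.2 = some ((d.1.1, d.2.1, d.2.2.1.1), d.1.2) ∧
    ∃ S, d.1.2 = stackType P 𝒜 S ∧
      d.2.2.1.2 = stackType P 𝒜 (Stream'.cons (some (d.1.1, d.2.1, d.2.2.1.1)) S)}
  pop := {d | (d.1.1, d.2.1, d.2.2.2.1) ∈ 𝒜.edges ∧
    ((∃ e, d.2.2.1 = some (e, d.2.2.2.2) ∧ (e, (d.1.1, d.2.1, d.2.2.2.1)) ∈ 𝒜.matched) ∨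
      (d.2.2.1 = none ∧ ∃ (o : Option (Q × A × Q)) (S : EdgeStack A Q),
        (∀ e ∈ o, (e, (d.1.1, d.2.1, d.2.2.2.1)) ∈ 𝒜.matched) ∧
        d.2.2.2.2 = stackType P 𝒜 S ∧ d.1.2 = stackType P 𝒜 (Stream'.cons o S)))}
  internal := {d | (d.1.1, d.2.1, d.2.2.1) ∈ 𝒜.edges ∧ d.2.2.2 = d.1.2}
  final := {s | s.1 ∈ s.2.2}

/-- The stack of `blockVPA`, lying over a stack of unspecified content, represents the stack `S`
of type `t`. -/
inductive Represents (P : PushdownAlphabet A) (𝒜 : DyckAutomaton A Q) :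
    List (Option ((Q × A × Q) × (Set Q × Set Q))) → Set Q × Set Q → EdgeStack A Q → Prop
  | nil (S : EdgeStack A Q) : Represents P 𝒜 [] (stackType P 𝒜 S) S
  | snoc {σ : List (Option ((Q × A × Q) × (Set Q × Set Q)))} {t : Set Q × Set Q}
      {S : EdgeStack A Q} (e : Q × A × Q) : Represents P 𝒜 σ t S →
      Represents P 𝒜 (σ ++ [some (e, t)]) (stackType P 𝒜 (Stream'.cons (some e) S))
        (Stream'.cons (some e) S)

variable {P : PushdownAlphabet A} {𝒜 : DyckAutomaton A Q}

theorem Represents.eq_stackType {σ : List (Option ((Q × A × Q) × (Set Q × Set Q)))}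
    {t : Set Q × Set Q} {S : EdgeStack A Q} (h : Represents P 𝒜 σ t S) :
    t = stackType P 𝒜 S := by
  cases h <;> rfl

theorem Represents.of_snoc {σ : List (Option ((Q × A × Q) × (Set Q × Set Q)))}
    {t t₀ : Set Q × Set Q} {e : Q × A × Q} {S : EdgeStack A Q}
    (h : Represents P 𝒜 (σ ++ [some (e, t₀)]) t S) :
    ∃ S₀, S = Stream'.cons (some e) S₀ ∧ Represents P 𝒜 σ t₀ S₀ := by
  generalize hρ : σ ++ [some (e, t₀)] = ρ at h
  cases h with
  | nil _ => simp at hρ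
  | snoc e' h =>
    obtain ⟨rfl, h₂⟩ := List.append_inj' hρ rfl
    simp only [List.cons.injEq, Option.some.injEq, Prod.mk.injEq, and_true] at h₂
    obtain ⟨rfl, rfl⟩ := h₂
    exact ⟨_, rfl, h⟩

theorem exists_configRun_of_steps {k k' : (Q × (Set Q × Set Q)) × _} {w : List A}
    (h : VPA.Steps P (blockVPA P 𝒜) k w k') (hfin : k'.1 ∈ (blockVPA P 𝒜).final)
    (hrep : ∃ S, Represents P 𝒜 k.2 k.1.2 S) :
    ∃ S c', Represents P 𝒜 k.2 k.1.2 S ∧ ConfigRun P 𝒜 (k.1.1, S) w c' ∧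
      RightExtendable P 𝒜 c' := by
  induction h with
  | refl k =>
    obtain ⟨S, hS⟩ := hrep
    refine ⟨S, _, hS, .nil _, ?_⟩
    have hfin : k.1.1 ∈ k.1.2.2 := hfin
    rw [hS.eq_stackType] at hfin
    exact hfin
  | @call p σ a q γ w c hk hpush _ _ ih =>
    obtain ⟨S, hS⟩ := hrep
    obtain ⟨he, hγ, S₁, hS₁, hq⟩ := hpush
    dsimp only at he hγ hS₁ hq hS
    subst hγ
    have hq' := hq.trans (stackType_cons_congr (hS₁.symm.trans hS.eq_stackType) _)
    obtain ⟨S₂, c', h₂, hrun, hc'⟩ := ih hfin ⟨_, by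
      dsimp only
      rw [hq']
      exact hS.snoc _⟩
    obtain ⟨S₃, rfl, h₃⟩ := h₂.of_snoc
    exact ⟨S₃, c', h₃, .cons ⟨he, .call _ hk⟩ hrun, hc'⟩
  | @pop p σ a γ q w c hk hpop hγ _ ih =>
    obtain ⟨S, hS⟩ := hrep
    obtain ⟨he, ⟨e, hγe, hm⟩ | ⟨h, -⟩⟩ := hpop
    · dsimp only at he hγe hm hS
      subst hγe
      obtain ⟨S₀, rfl, h₀⟩ := hS.of_snoc
      obtain ⟨S₁, c', h₁, hrun, hc'⟩ := ih hfin ⟨S₀, h₀⟩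
      refine ⟨Stream'.cons (some e) S₁, c', ?_,
        .cons ⟨he, .ret _ _ hk fun e' he' => ?_⟩ hrun, hc'⟩
      · dsimp only
        rw [hS.eq_stackType, stackType_cons_congr (h₀.eq_stackType.symm.trans h₁.eq_stackType)]
        exact h₁.snoc _
      · obtain rfl := Option.some.inj he'
        exact hm
    · exact absurd h hγ
  | @popBot p a q w c hk hpop _ ih =>
    obtain ⟨he, ⟨e, hγe, hm⟩ | ⟨-, o, S, hm, hq, hp⟩⟩ := hpop
    · exact absurd hγe (by simp [blockVPA])
    · dsimp only at he hm hq hp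
      obtain ⟨S₁, c', h₁, hrun, hc'⟩ := ih hfin ⟨S, by
        dsimp only
        rw [hq]
        exact .nil S⟩
      refine ⟨Stream'.cons o S₁, c', ?_, .cons ⟨he, .ret _ _ hk hm⟩ hrun, hc'⟩
      dsimp only
      rw [hp, stackType_cons_congr (hq.symm.trans h₁.eq_stackType)]
      exact .nil _
  | @internal p σ a q w c hk hint _ ih =>
    obtain ⟨he, hq⟩ := hint
    dsimp only at he hq hrep ih
    rw [hq] at ih
    obtain ⟨S₁, c', h₁, hrun, hc'⟩ := ih hfin hrep
    exact ⟨S₁, c', h₁, .cons (d := (q.1, S₁)) ⟨he, .intern _ hk⟩ hrun, hc'⟩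

theorem exists_steps_of_configRun {c c' : Q × EdgeStack A Q} {w : List A}
    (h : ConfigRun P 𝒜 c w c') (hc' : RightExtendable P 𝒜 c')
    {σ : List (Option ((Q × A × Q) × (Set Q × Set Q)))} {t : Set Q × Set Q}
    (hrep : Represents P 𝒜 σ t c.2) :
    ∃ k, VPA.Steps P (blockVPA P 𝒜) ((c.1, t), σ) w k ∧ k.1 ∈ (blockVPA P 𝒜).final := by
  induction h generalizing σ t with
  | nil c =>
    refine ⟨_, .refl _, ?_⟩
    change c.1 ∈ t.2
    rw [hrep.eq_stackType]
    exact hc'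
  | @cons c d c' a w hs _ ih =>
    obtain ⟨p, S⟩ := c
    obtain ⟨q, T⟩ := d
    obtain ⟨he, hs⟩ := hs
    dsimp only at he hs hrep ih ⊢
    cases hs with
    | call _ hk =>
      obtain ⟨k, hsteps, hfin⟩ := ih hc' (hrep.snoc (p, a, q))
      exact ⟨k, .call hk ⟨he, rfl, S, hrep.eq_stackType, rfl⟩ (by simp [blockVPA]) hsteps, hfin⟩
    | ret o _ hk hm =>
      generalize hU : Stream'.cons o T = U at hrep
      cases hrep with
      | nil _ =>
        obtain ⟨k, hsteps, hfin⟩ := ih hc' (.nil T)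
        exact ⟨k, .popBot hk ⟨he, .inr ⟨rfl, o, T, hm, rfl, by rw [hU]⟩⟩ hsteps, hfin⟩
      | snoc e h =>
        obtain ⟨rfl, rfl⟩ := Stream'.cons_injective2 hU
        obtain ⟨k, hsteps, hfin⟩ := ih hc' h
        exact ⟨k, .pop hk ⟨he, .inl ⟨e, rfl, hm e rfl⟩⟩ (by simp [blockVPA]) hsteps, hfin⟩
    | intern _ hk =>
      obtain ⟨k, hsteps, hfin⟩ := ih hc' hrep
      exact ⟨k, .internal (q := (q, t)) hk ⟨he, rfl⟩ hsteps, hfin⟩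

theorem blockVPA_accepts_iff {w : List A} :
    VPA.Accepts P (blockVPA P 𝒜) w ↔ w ∈ blocksOf (presents P 𝒜) := by
  rw [mem_blocksOf_presents_iff]
  constructor
  · rintro ⟨⟨p, t⟩, q, σ, ⟨S₀, hS₀, hp⟩, hq, hsteps⟩
    dsimp only at hS₀ hp
    obtain ⟨S, c', hS, hrun, hc'⟩ := exists_configRun_of_steps hsteps hq
      ⟨S₀, by dsimp only; rw [hS₀]; exact .nil _⟩
    refine ⟨(p, S), c', ?_, hrun, hc'⟩
    have := hS.eq_stackType
    dsimp only at this
    rw [this] at hp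
    exact hp
  · rintro ⟨⟨p, S⟩, c', hl, hrun, hr⟩
    obtain ⟨⟨q, σ⟩, hsteps, hfin⟩ := exists_steps_of_configRun hrun hr (.nil S)
    exact ⟨(p, stackType P 𝒜 S), q, σ, ⟨S, rfl, hl⟩, hfin, hsteps⟩

end Automaton

section Transport

variable {A Q Γ Q' Γ' : Type*}

/-- The pullback of a visibly pushdown automaton along bijections of the states and of the
stack alphabet. -/
def VPA.comap (V : VPA A Q Γ) (f : Q' ≃ Q) (g : Γ' ≃ Γ) : VPA A Q' Γ' where
  init := {p | f p ∈ V.init}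
  bot := g.symm V.bot
  push := {d | (f d.1, d.2.1, f d.2.2.1, g d.2.2.2) ∈ V.push}
  pop := {d | (f d.1, d.2.1, g d.2.2.1, f d.2.2.2) ∈ V.pop}
  internal := {d | (f d.1, d.2.1, f d.2.2) ∈ V.internal}
  final := {p | f p ∈ V.final}

theorem VPA.Steps.of_comap {P : PushdownAlphabet A} {V : VPA A Q Γ} {f : Q' ≃ Q} {g : Γ' ≃ Γ}
    {k k' : Q' × List Γ'} {w : List A} (h : VPA.Steps P (V.comap f g) k w k') :
    VPA.Steps P V (f k.1, k.2.map g) w (f k'.1, k'.2.map g) := by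
  have hbot : ∀ {γ : Γ'}, γ ≠ (V.comap f g).bot → g γ ≠ V.bot := fun {γ} hne heq =>
    hne (by rw [← g.symm_apply_apply γ, heq]; rfl)
  induction h with
  | refl k => exact .refl _
  | call hk hpush hne _ ih =>
    refine .call hk hpush (hbot hne) ?_
    simpa using ih
  | pop hk hpop hne _ ih =>
    simp only [List.map_append, List.map_cons, List.map_nil]
    exact .pop hk hpop (hbot hne) ih
  | popBot hk hpop _ ih =>
    refine .popBot hk ?_ ih
    simpa [VPA.comap] using hpop
  | internal hk hint _ ih => exact .internal hk hint ih

theorem VPA.comap_symm_comap (V : VPA A Q Γ) (f : Q' ≃ Q) (g : Γ' ≃ Γ) :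
    (V.comap f g).comap f.symm g.symm = V := by
  cases V
  simp [VPA.comap]

theorem VPA.Accepts.of_comap {P : PushdownAlphabet A} {V : VPA A Q Γ} {f : Q' ≃ Q} {g : Γ' ≃ Γ}
    {w : List A} (h : VPA.Accepts P (V.comap f g) w) : VPA.Accepts P V w := by
  obtain ⟨p, q, σ, hp, hq, hs⟩ := h
  exact ⟨f p, f q, σ.map g, hp, hq, hs.of_comap⟩

theorem VPA.accepts_comap_iff {P : PushdownAlphabet A} {V : VPA A Q Γ} {f : Q' ≃ Q}
    {g : Γ' ≃ Γ} {w : List A} : VPA.Accepts P (V.comap f g) w ↔ VPA.Accepts P V w := by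
  refine ⟨VPA.Accepts.of_comap, fun h => ?_⟩
  rw [← V.comap_symm_comap f g] at h
  exact h.of_comap

theorem isVPL_setOf_accepts [Finite Q] [Finite Γ] (P : PushdownAlphabet A)
    (V : VPA A Q (Option Γ)) : IsVPL P {w | VPA.Accepts P V w} := by
  have e : Fin (Nat.card Γ + 1) ≃ Option Γ :=
    (finSuccEquiv _).trans (Equiv.optionCongr (Finite.equivFin Γ).symm)
  refine ⟨Nat.card Q, Nat.card Γ, V.comap (Finite.equivFin Q).symm e, ?_⟩
  ext w
  exact VPA.accepts_comap_iff.symm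

end Transport

end SD

/-- The set of blocks of a sofic-Dyck shift is a visibly pushdown language. -/
theorem statement_13 {A : Type*} [Fintype A] (P : PushdownAlphabet A)
    (X : Set (ℤ → A)) (hX : IsSoficDyck P X) :
    IsVPL P (blocksOf X) := by
  obtain ⟨N, 𝒜, -, rfl⟩ := hX
  have h : blocksOf (presents P 𝒜) = {w | VPA.Accepts P (blockVPA P 𝒜) w} := by
    ext w
    exact blockVPA_accepts_iff.symm
  rw [h]
  exact isVPL_setOf_accepts P _
end
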